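/- Let d ≥ 1, k ≥ 1 be fixed integers, s ∈ (0,2] and L > 0. There exists a constant C depending only on s, L, d and k such that for every n ≥ k, every probability density f in the Hölder ball H^s_d(L;[0,1]^d), and every x ∈ [0,1]^d, if X_1,…,X_n are i.i.d. samples from f and R_k(x) denotes the k-th smallest torus distance from x to X_1,…,X_n, then E[ ( f_{R_k(x)}(x) − f(x) )^2 ] ≤ C n^{−2s/(s+d)}. -/

import Mathlib

open MeasureTheory Real

noncomputable section

abbrev Euc (d : ℕ) : Type := EuclideanSpace ℝ (Fin d)

/-- The unit cube `[0,1]^d`. -/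
def unitCube (d : ℕ) : Set (Euc d) := {x | ∀ i, x i ∈ Set.Icc (0:ℝ) 1}

/-- Volume of the unit Euclidean ball in `ℝ^d`. -/
def unitBallVol (d : ℕ) : ℝ := Real.pi ^ ((d : ℝ) / 2) / Real.Gamma (1 + (d : ℝ) / 2)

/-- The point of `ℝ^d` with integer coordinates `m`. -/
def intVec (d : ℕ) (m : Fin d → ℤ) : Euc d :=
  (WithLp.equiv 2 (Fin d → ℝ)).symm fun i => (m i : ℝ)

/-- Torus distance: `d(x,y) = min_{m ∈ ℤ^d} ‖x + m - y‖`. -/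
def torusDist (d : ℕ) (x y : Euc d) : ℝ :=
  ⨅ m : Fin d → ℤ, ‖x + intVec d m - y‖

/-- `(s,L)`-Hölder condition for `s ∈ (0,2]`. -/
def IsHolderOrder (d : ℕ) (s L : ℝ) (f : Euc d → ℝ) : Prop :=
  if s ≤ 1 then
    ∀ x y : Euc d, |f x - f y| ≤ L * ‖x - y‖ ^ s
  else
    ContDiff ℝ 1 f ∧ ∀ x y : Euc d, ‖gradient f x - gradient f y‖ ≤ L * ‖x - y‖ ^ (s - 1)

/-- `f` is 1-periodic in each coordinate. -/
def IsPeriodic (d : ℕ) (f : Euc d → ℝ) : Prop :=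
  ∀ (x : Euc d) (i : Fin d), f (x + EuclideanSpace.single i 1) = f x

/-- Probability density in the Hölder ball `H^s_d(L;[0,1]^d)`, represented by its
1-periodic extension to `ℝ^d`. -/
def HolderDensity (d : ℕ) (s L : ℝ) (f : Euc d → ℝ) : Prop :=
  IsHolderOrder d s L f ∧ IsPeriodic d f ∧ (∀ x, 0 ≤ f x) ∧
    (∫ x in unitCube d, f x) = 1

/-- The probability measure on `[0,1]^d` with density `f`. -/
def densityMeasure (d : ℕ) (f : Euc d → ℝ) : Measure (Euc d) :=
  (volume.restrict (unitCube d)).withDensity fun x => ENNReal.ofReal (f x)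

/-- Law of `n` i.i.d. samples from density `f`. -/
def sampleMeasure (d n : ℕ) (f : Euc d → ℝ) : Measure (Fin n → Euc d) :=
  Measure.pi fun _ => densityMeasure d f

/-- The `k`-th smallest element (1-indexed) of a multiset of reals. -/
def kthSmallest (s : Multiset ℝ) (k : ℕ) : ℝ :=
  (s.sort (· ≤ ·)).getD (k - 1) 0

/-- `R_{i,k}`: the `k`-nearest neighbor torus distance from `X i` to the other points. -/
def nnDist (d n : ℕ) (X : Fin n → Euc d) (i : Fin n) (k : ℕ) : ℝ :=
  kthSmallest ((Finset.univ.erase i).val.map fun j => torusDist d (X i) (X j)) k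

/-- The digamma function: derivative of `ln Γ`. -/
def digamma (x : ℝ) : ℝ := deriv (fun y => Real.log (Real.Gamma y)) x

/-- The Kozachenko–Leonenko `k`-nearest neighbor differential entropy estimator. -/
def klEstimator (d k n : ℕ) (X : Fin n → Euc d) : ℝ :=
  Real.log k - digamma k +
    (1 / n : ℝ) * ∑ i : Fin n, Real.log ((n / k : ℝ) * (unitBallVol d * nnDist d n X i k ^ d))

/-- Differential entropy `h(f) = -∫_{[0,1]^d} f ln f`. -/
def diffEntropy (d : ℕ) (f : Euc d → ℝ) : ℝ :=
  -∫ x in unitCube d, f x * Real.log (f x)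

end

noncomputable section

/-- `f_t(x)`: the average of `f` over the closed Euclidean ball `B(x,t)`,
`f_t(x) = (1/(V_d t^d)) ∫_{‖u-x‖ ≤ t} f(u) du`. -/
def ballAvg (d : ℕ) (f : Euc d → ℝ) (t : ℝ) (x : Euc d) : ℝ :=
  (1 / (unitBallVol d * t ^ d)) * ∫ u in Metric.closedBall x t, f u

/-- `R_k(x)`: the `k`-th smallest torus distance from the point `x` to the sample points. -/
def RkOfPoint (d n k : ℕ) (x : Euc d) (X : Fin n → Euc d) : ℝ :=
  kthSmallest (Finset.univ.val.map fun j : Fin n => torusDist d x (X j)) k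

end

section HolderFunctions

variable {d : ℕ} {s L : ℝ} {f : Euc d → ℝ}

lemma unitBallVol_pos (d : ℕ) : 0 < unitBallVol d := by
  unfold unitBallVol
  have : 0 < Real.Gamma (1 + (d : ℝ) / 2) := Real.Gamma_pos_of_pos (by positivity)
  positivity

lemma volume_real_closedBall_one (hd : 1 ≤ d) :
    volume.real (Metric.closedBall (0 : Euc d) 1) = unitBallVol d := by
  have : Nonempty (Fin d) := ⟨⟨0, hd⟩⟩
  have hV := unitBallVol_pos d
  have hsqrt : √Real.pi ^ d = Real.pi ^ ((d : ℝ) / 2) := by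
    rw [Real.sqrt_eq_rpow, ← Real.rpow_natCast, ← Real.rpow_mul Real.pi_pos.le]
    congr 1
    ring
  rw [Measure.real, EuclideanSpace.volume_closedBall]
  simp only [ENNReal.ofReal_one, one_pow, one_mul, Fintype.card_fin]
  rw [hsqrt, add_comm ((d : ℝ) / 2)]
  exact ENNReal.toReal_ofReal hV.le

lemma IsHolderOrder.continuous (hs : 0 < s) (hf : IsHolderOrder d s L f) : Continuous f := by
  unfold IsHolderOrder at hf
  split_ifs at hf with h
  · refine continuous_iff_continuousAt.2 fun x => ?_
    rw [ContinuousAt, tendsto_iff_dist_tendsto_zero]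
    have hlim : Filter.Tendsto (fun y => L * ‖y - x‖ ^ s) (nhds x) (nhds 0) := by
      have hc : Continuous fun y : Euc d => L * ‖y - x‖ ^ s :=
        continuous_const.mul ((continuous_id.sub continuous_const).norm.rpow_const
          fun _ => Or.inr hs.le)
      simpa [Real.zero_rpow hs.ne'] using hc.tendsto x
    exact squeeze_zero (fun _ => dist_nonneg) (fun y => hf y x) hlim
  · exact hf.1.continuous

/-- A Hölder function is, up to an error `L ‖h‖ ^ s`, affine near each point. -/
lemma IsHolderOrder.exists_linear_approx (hL : 0 ≤ L) (hf : IsHolderOrder d s L f) (x : Euc d) :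
    ∃ φ : Euc d →L[ℝ] ℝ, ∀ h, |f (x + h) - f x - φ h| ≤ L * ‖h‖ ^ s := by
  unfold IsHolderOrder at hf
  split_ifs at hf with hs
  · exact ⟨0, fun h => by simpa using hf (x + h) x⟩
  · obtain ⟨hdiff, hgrad⟩ := hf
    push Not at hs
    refine ⟨fderiv ℝ f x, fun h => ?_⟩
    have hbound : ∀ y ∈ segment ℝ x (x + h),
        ‖fderiv ℝ f y - fderiv ℝ f x‖ ≤ L * ‖h‖ ^ (s - 1) := by
      intro y hy
      rw [← toDual_gradient, ← toDual_gradient, ← map_sub, LinearIsometryEquiv.norm_map]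
      refine (hgrad y x).trans ?_
      have hyx : ‖y - x‖ ≤ ‖h‖ := by
        simpa using norm_sub_le_of_mem_segment hy
      gcongr
    have hmv := Convex.norm_image_sub_le_of_norm_fderiv_le'
      (fun y _ => (hdiff.differentiable one_ne_zero) y) hbound (convex_segment x (x + h))
      (left_mem_segment ℝ x (x + h)) (right_mem_segment ℝ x (x + h))
    rw [add_sub_cancel_left, Real.norm_eq_abs] at hmv
    refine hmv.trans_eq ?_
    rcases eq_or_ne h 0 with rfl | hne
    · simp [Real.zero_rpow (by linarith : s ≠ 0)]
    · rw [mul_assoc, ← Real.rpow_add_one (norm_ne_zero_iff.2 hne), sub_add_cancel]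

open scoped Pointwise in
lemma setIntegral_closedBall_eq (f : Euc d → ℝ) (x : Euc d) {t : ℝ} (ht : 0 < t) :
    ∫ u in Metric.closedBall x t, f u
      = t ^ d * ∫ v in Metric.closedBall (0 : Euc d) 1, f (x + t • v) := by
  have h1 := (measurePreserving_add_left (volume : Measure (Euc d)) x).setIntegral_preimage_emb
    (measurableEmbedding_addLeft x) f (Metric.closedBall x t)
  have h2 := Measure.setIntegral_comp_smul_of_pos (volume : Measure (Euc d))
    (fun u => f (x + u)) (Metric.closedBall 0 1) ht
  have hpre : (fun u => x + u) ⁻¹' Metric.closedBall x t = Metric.closedBall 0 t := by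
    ext u; simp [dist_eq_norm]
  have hsm : t • Metric.closedBall (0 : Euc d) 1 = Metric.closedBall 0 t := by
    rw [smul_closedBall' ht.ne']; simp [abs_of_pos ht]
  rw [hsm] at h2
  rw [← h1, hpre, h2, finrank_euclideanSpace_fin, smul_eq_mul, mul_inv_cancel_left₀]
  positivity

lemma setIntegral_unitBall_clm (φ : Euc d →L[ℝ] ℝ) :
    ∫ v in Metric.closedBall (0 : Euc d) 1, φ v = 0 := by
  have h := (Measure.measurePreserving_neg (volume : Measure (Euc d))).setIntegral_preimage_emb
    (MeasurableEquiv.neg (Euc d)).measurableEmbedding φ (Metric.closedBall 0 1)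
  have hpre : Neg.neg ⁻¹' Metric.closedBall (0 : Euc d) 1 = Metric.closedBall 0 1 := by
    ext u; simp
  rw [hpre] at h
  simp only [map_neg, integral_neg] at h
  linarith

lemma abs_ballAvg_sub_le (hd : 1 ≤ d) (hs : 0 < s) (hL : 0 ≤ L) (hf : IsHolderOrder d s L f)
    (x : Euc d) {t : ℝ} (ht : 0 < t) : |ballAvg d f t x - f x| ≤ L * t ^ s := by
  obtain ⟨φ, hφ⟩ := hf.exists_linear_approx hL x
  have hV := unitBallVol_pos d
  have hvol := volume_real_closedBall_one hd
  have hcont := hf.continuous hs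
  have hK := isCompact_closedBall (0 : Euc d) 1
  have hint : IntegrableOn (fun v => f (x + t • v)) (Metric.closedBall (0 : Euc d) 1) :=
    ContinuousOn.integrableOn_compact hK (by fun_prop)
  have hintφ : IntegrableOn (fun v => φ (t • v)) (Metric.closedBall (0 : Euc d) 1) :=
    ContinuousOn.integrableOn_compact hK (by fun_prop)
  have hconst : IntegrableOn (fun _ => f x) (Metric.closedBall (0 : Euc d) 1) :=
    ContinuousOn.integrableOn_compact hK (by fun_prop)
  have hzero : ∫ v in Metric.closedBall (0 : Euc d) 1, φ (t • v) = 0 := by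
    simp only [map_smul, integral_smul, setIntegral_unitBall_clm, smul_zero]
  have hbound : ‖∫ v in Metric.closedBall (0 : Euc d) 1, (f (x + t • v) - f x - φ (t • v))‖
      ≤ L * t ^ s * unitBallVol d := by
    rw [← hvol]
    refine norm_setIntegral_le_of_norm_le_const hK.measure_lt_top fun v hv => ?_
    refine (hφ (t • v)).trans ?_
    have : ‖t • v‖ ≤ t := by
      rw [norm_smul, Real.norm_of_nonneg ht.le]
      exact mul_le_of_le_one_right ht.le (mem_closedBall_zero_iff.1 hv)
    gcongr
  have hsplit : ∫ v in Metric.closedBall (0 : Euc d) 1, (f (x + t • v) - f x - φ (t • v))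
      = (∫ v in Metric.closedBall (0 : Euc d) 1, f (x + t • v)) - unitBallVol d * f x := by
    refine (integral_sub (hint.sub hconst) hintφ).trans ?_
    rw [hzero, sub_zero]
    refine (integral_sub hint hconst).trans ?_
    rw [setIntegral_const, hvol, smul_eq_mul]
  rw [hsplit, Real.norm_eq_abs] at hbound
  have heq : ballAvg d f t x - f x = (unitBallVol d)⁻¹ *
      ((∫ v in Metric.closedBall (0 : Euc d) 1, f (x + t • v)) - unitBallVol d * f x) := by
    rw [ballAvg, setIntegral_closedBall_eq f x ht]
    field_simp
  rw [heq, abs_mul, abs_of_pos (inv_pos.2 hV), inv_mul_le_iff₀ hV, mul_comm _ (L * t ^ s)]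
  exact hbound

/-- Every value below the mass of `closedBall x T` is the mass of a smaller concentric ball. -/
lemma exists_setIntegral_closedBall_eq (hd : 1 ≤ d) (hf : Continuous f) (x : Euc d) {T c : ℝ}
    (hT : 0 ≤ T) (hc : 0 < c) (hcT : c ≤ ∫ u in Metric.closedBall x T, f u) :
    ∃ t, 0 < t ∧ t ≤ T ∧ ∫ u in Metric.closedBall x t, f u = c := by
  set G : ℝ → ℝ := fun t => t ^ d * ∫ v in Metric.closedBall (0 : Euc d) 1, f (x + t • v)
  have hG : Continuous G := by
    refine (continuous_pow d).mul
      (continuous_parametric_integral_of_continuous ?_ (isCompact_closedBall (0 : Euc d) 1))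
    fun_prop
  have hG0 : G 0 = 0 := by simp [G, zero_pow (by omega : d ≠ 0)]
  have hTpos : 0 < T := by
    have : Nonempty (Fin d) := ⟨⟨0, hd⟩⟩
    rcases hT.eq_or_lt with rfl | h
    · simp [Metric.closedBall_zero] at hcT
      linarith
    · exact h
  rw [setIntegral_closedBall_eq f x hTpos] at hcT
  obtain ⟨t, ht, htc⟩ := intermediate_value_Icc hT hG.continuousOn
    ⟨hG0.trans_le hc.le, hcT⟩
  have htpos : 0 < t := by
    rcases ht.1.eq_or_lt with rfl | h
    · rw [hG0] at htc; linarith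
    · exact h
  exact ⟨t, htpos, ht.2, (setIntegral_closedBall_eq f x htpos).trans htc⟩

end HolderFunctions

lemma setIntegral_biUnion_finset_le {α ι : Type*} [MeasurableSpace α] {μ : Measure α} {f : α → ℝ}
    (hf : ∀ x, 0 ≤ f x) {A : ι → Set α} (S : Finset ι) (hint : ∀ i ∈ S, IntegrableOn f (A i) μ) :
    ∫ x in ⋃ i ∈ S, A i, f x ∂μ ≤ ∑ i ∈ S, ∫ x in A i, f x ∂μ := by
  classical
  induction S using Finset.induction_on with
  | empty => simp
  | insert i S hi ih =>
    have hS : ∀ j ∈ S, IntegrableOn f (A j) μ := fun j hj => hint j (Finset.mem_insert_of_mem hj)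
    have hi' := hint i (Finset.mem_insert_self i S)
    have hU : IntegrableOn f (⋃ j ∈ S, A j) μ := integrableOn_finset_iUnion.2 hS
    rw [Finset.set_biUnion_insert, Finset.sum_insert hi]
    refine (integral_mono_measure (Measure.restrict_union_le _ _) (.of_forall hf)
      (Integrable.add_measure hi' hU)).trans ?_
    rw [integral_add_measure hi' hU]
    exact add_le_add le_rfl (ih hS)

section OrderStatistics

lemma kthSmallest_mem {S : Multiset ℝ} {k : ℕ} (hk : 1 ≤ k) (hkS : k ≤ S.card) :
    kthSmallest S k ∈ S := by
  have hlen : k - 1 < (S.sort (· ≤ ·)).length := by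
    rw [Multiset.length_sort]; omega
  rw [kthSmallest, List.getD_eq_getElem _ _ hlen, ← Multiset.mem_sort (· ≤ ·)]
  exact List.getElem_mem hlen

/-- Fewer than `k` elements lie below the `k`-th smallest one. -/
lemma countP_le_lt_of_lt_kthSmallest {S : Multiset ℝ} {k : ℕ} (hk : 1 ≤ k) (hkS : k ≤ S.card)
    {t : ℝ} (ht : t < kthSmallest S k) : S.countP (· ≤ t) < k := by
  set l := S.sort (· ≤ ·) with hl
  have hlen : k - 1 < l.length := by
    rw [hl, Multiset.length_sort]; omega
  have hS : S = (l : Multiset ℝ) := (Multiset.sort_eq S (· ≤ ·)).symm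
  rw [kthSmallest, ← hl, List.getD_eq_getElem _ _ hlen] at ht
  have hdrop : (l.drop (k - 1)).countP (· ≤ t) = 0 := by
    rw [List.countP_eq_zero]
    intro a ha
    rw [List.drop_eq_getElem_cons hlen, List.mem_cons] at ha
    have hle : l[k - 1] ≤ a := by
      rcases ha with rfl | ha
      · exact le_rfl
      · have hsorted : l.Pairwise (· ≤ ·) := Multiset.pairwise_sort S (· ≤ ·)
        have hd := hsorted.drop (i := k - 1)
        rw [List.drop_eq_getElem_cons hlen] at hd
        exact List.rel_of_pairwise_cons hd ha
    simpa using ht.trans_le hle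
  have htake : (l.take (k - 1)).countP (· ≤ t) ≤ k - 1 :=
    List.countP_le_length.trans (by simp)
  have hsum : S.countP (· ≤ t) = (l.take (k - 1)).countP (· ≤ t)
      + (l.drop (k - 1)).countP (· ≤ t) := by
    rw [← List.countP_append, List.take_append_drop, hS, Multiset.coe_countP]
  omega

variable {d n k : ℕ}

lemma exists_RkOfPoint_eq (hk : 1 ≤ k) (hkn : k ≤ n) (x : Euc d) (X : Fin n → Euc d) :
    ∃ i, RkOfPoint d n k x X = torusDist d x (X i) := by
  have h := kthSmallest_mem (S := Finset.univ.val.map fun j : Fin n => torusDist d x (X j)) hk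
    (by simpa using hkn)
  obtain ⟨i, -, hi⟩ := Multiset.mem_map.1 h
  exact ⟨i, hi.symm⟩

lemma card_torusDist_le_lt (hk : 1 ≤ k) (hkn : k ≤ n) {x : Euc d} {X : Fin n → Euc d} {t : ℝ}
    (ht : t < RkOfPoint d n k x X) :
    (Finset.univ.filter fun i => torusDist d x (X i) ≤ t).card < k := by
  have h := countP_le_lt_of_lt_kthSmallest hk (by simpa using hkn) ht
  rw [Multiset.countP_map] at h
  exact h

end OrderStatistics

section Torus

variable {d : ℕ} {f : Euc d → ℝ}

@[simp]
lemma intVec_apply (m : Fin d → ℤ) (i : Fin d) : intVec d m i = m i := rfl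

lemma IsPeriodic.add_intVec (hf : IsPeriodic d f) (m : Fin d → ℤ) :
    Function.Periodic f (intVec d m) := by
  have hsum : intVec d m = ∑ i, m i • EuclideanSpace.single i (1 : ℝ) := by
    ext j
    simp [Finset.sum_apply, Pi.single_apply]
  rw [hsum]
  refine Finset.sum_induction _ (Function.Periodic f) (fun _ _ => Function.Periodic.add_period)
    (fun y => by rw [add_zero]) fun i _ => ?_
  exact Function.Periodic.zsmul (fun y => hf y i) (m i)

lemma torusDist_le (x y : Euc d) (m : Fin d → ℤ) : torusDist d x y ≤ ‖x + intVec d m - y‖ :=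
  ciInf_le ⟨0, by rintro _ ⟨m, rfl⟩; exact norm_nonneg _⟩ m

lemma torusDist_nonneg (x y : Euc d) : 0 ≤ torusDist d x y :=
  le_ciInf fun _ => norm_nonneg _

lemma norm_le_dim_of_abs_le_one {z : Euc d} (hz : ∀ i, |z i| ≤ 1) : ‖z‖ ≤ d := by
  rw [EuclideanSpace.norm_eq]
  have h1 : ∑ i, ‖z i‖ ^ 2 ≤ d := by
    refine (Finset.sum_le_card_nsmul Finset.univ _ 1 fun i _ => ?_).trans (by simp)
    exact pow_le_one₀ (norm_nonneg _) (hz i)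
  refine Real.sqrt_le_iff.2 ⟨Nat.cast_nonneg d, h1.trans ?_⟩
  exact_mod_cast Nat.le_self_pow two_ne_zero d

lemma torusDist_le_dim (x y : Euc d) : torusDist d x y ≤ d := by
  refine (torusDist_le x y fun i => -⌊x i - y i⌋).trans (norm_le_dim_of_abs_le_one fun i => ?_)
  have h1 := Int.floor_le (x i - y i)
  have h2 := Int.lt_floor_add_one (x i - y i)
  simp only [PiLp.sub_apply, PiLp.add_apply, intVec_apply, Int.cast_neg]
  rw [abs_le]
  constructor <;> linarith

lemma intVec_eq_of_norm_lt {m m' : Fin d → ℤ} (h : ‖intVec d m - intVec d m'‖ < 1) : m = m' := by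
  funext i
  have hi := (PiLp.norm_apply_le (intVec d m - intVec d m') i).trans_lt h
  simp only [PiLp.sub_apply, intVec_apply, Real.norm_eq_abs] at hi
  have : |m i - m' i| < 1 := by exact_mod_cast hi
  rw [Int.abs_lt_one_iff] at this
  omega

lemma eq_add_intVec_of_torusDist_eq_zero {x y : Euc d} (h : torusDist d x y = 0) :
    ∃ m, y = x + intVec d m := by
  have hex : ∀ ε > 0, ∃ m, ‖x + intVec d m - y‖ < ε := fun ε hε =>
    exists_lt_of_ciInf_lt (h.trans_lt hε)
  obtain ⟨m, hm⟩ := hex (1 / 2) (by norm_num)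
  refine ⟨m, ?_⟩
  by_contra hne
  have hpos : 0 < ‖x + intVec d m - y‖ := norm_pos_iff.2 fun h0 => hne (sub_eq_zero.1 h0).symm
  obtain ⟨m', hm'⟩ := hex _ hpos
  have hmm : m = m' := by
    refine intVec_eq_of_norm_lt ?_
    have heq : intVec d m - intVec d m' = (x + intVec d m - y) - (x + intVec d m' - y) := by abel
    rw [heq]
    exact (norm_sub_le _ _).trans_lt (by linarith)
  rw [← hmm] at hm'
  exact hm'.false

lemma volume_torusDist_eq_zero (hd : 1 ≤ d) (x : Euc d) :
    volume {y | torusDist d x y = 0} = 0 := by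
  have : Nonempty (Fin d) := ⟨⟨0, hd⟩⟩
  refine measure_mono_null (t := Set.range fun m => x + intVec d m) ?_
    ((Set.countable_range _).measure_zero _)
  rintro y hy
  obtain ⟨m, rfl⟩ := eq_add_intVec_of_torusDist_eq_zero hy
  exact ⟨m, rfl⟩

/-- The integer translates of the unit cube that may meet a ball of radius `d` centred in it. -/
noncomputable def nearbyShifts (d : ℕ) : Finset (Fin d → ℤ) :=
  Fintype.piFinset fun _ => Finset.Icc (-(d : ℤ)) (d + 1)

lemma nearbyShifts_card_pos (d : ℕ) : 0 < (nearbyShifts d).card := by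
  refine Finset.card_pos.2 ⟨0, ?_⟩
  simp only [nearbyShifts, Fintype.mem_piFinset, Finset.mem_Icc, Pi.zero_apply]
  omega

/-- The part of the unit cube at torus distance at most `t` from `x`. -/
def torusBall (d : ℕ) (x : Euc d) (t : ℝ) : Set (Euc d) :=
  unitCube d ∩ ⋃ m : Fin d → ℤ, Metric.closedBall (x + intVec d m) t

lemma measurableSet_unitCube (d : ℕ) : MeasurableSet (unitCube d) := by
  have : unitCube d = ⋂ i, (fun x : Euc d => x i) ⁻¹' Set.Icc 0 1 := by
    ext; simp [unitCube]
  rw [this]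
  exact MeasurableSet.iInter fun i => measurableSet_Icc.preimage (by fun_prop)

lemma isCompact_unitCube (d : ℕ) : IsCompact (unitCube d) := by
  refine Metric.isCompact_of_isClosed_isBounded ?_ ?_
  · have : unitCube d = ⋂ i, (fun x : Euc d => x i) ⁻¹' Set.Icc 0 1 := by
      ext; simp [unitCube]
    rw [this]
    exact isClosed_iInter fun i => isClosed_Icc.preimage (by fun_prop)
  · refine (Metric.isBounded_closedBall (x := (0 : Euc d)) (r := d)).subset fun x hx => ?_
    refine mem_closedBall_zero_iff.2 (norm_le_dim_of_abs_le_one fun i => ?_)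
    exact abs_le.2 ⟨by linarith [(hx i).1], (hx i).2⟩

lemma measurableSet_torusBall (x : Euc d) (t : ℝ) : MeasurableSet (torusBall d x t) :=
  (measurableSet_unitCube d).inter (MeasurableSet.iUnion fun _ => measurableSet_closedBall)

lemma torusDist_le_of_mem_torusBall {x y : Euc d} {t : ℝ} (hy : y ∈ torusBall d x t) :
    torusDist d x y ≤ t := by
  obtain ⟨m, hm⟩ := Set.mem_iUnion.1 hy.2
  rw [Metric.mem_closedBall', dist_eq_norm] at hm
  exact (torusDist_le x y m).trans hm

lemma closedBall_subset_iUnion_torusBall {x : Euc d} (hx : x ∈ unitCube d) {t : ℝ} (ht : t ≤ d) :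
    Metric.closedBall x t ⊆
      ⋃ m ∈ nearbyShifts d, (fun u => u + intVec d (-m)) ⁻¹' torusBall d x t := by
  intro u hu
  rw [Metric.mem_closedBall, dist_eq_norm] at hu
  refine Set.mem_iUnion₂.2 ⟨fun i => ⌊u i⌋, ?_, fun i => ?_, Set.mem_iUnion.2 ⟨fun i => -⌊u i⌋, ?_⟩⟩
  · simp only [nearbyShifts, Fintype.mem_piFinset, Finset.mem_Icc]
    intro i
    have h := ((PiLp.norm_apply_le (u - x) i).trans hu).trans ht
    rw [PiLp.sub_apply, Real.norm_eq_abs, abs_le] at h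
    have hxi := hx i
    constructor
    · refine Int.le_floor.2 ?_
      push_cast
      linarith [hxi.1]
    · have h2 : (⌊u i⌋ : ℝ) ≤ ((d + 1 : ℤ) : ℝ) := by
        push_cast
        linarith [hxi.2, Int.floor_le (u i)]
      exact_mod_cast h2
  · simp only [PiLp.add_apply, intVec_apply, Pi.neg_apply, Int.cast_neg, Set.mem_Icc]
    constructor <;> linarith [Int.floor_le (u i), Int.lt_floor_add_one (u i)]
  · rw [Metric.mem_closedBall, dist_eq_norm]
    refine (congrArg norm ?_).trans_le hu
    change u + intVec d (fun i => -⌊u i⌋) - _ = _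
    abel

/-- The Euclidean ball wraps around the torus at most `(nearbyShifts d).card` times. -/
lemma setIntegral_closedBall_le (hf : Continuous f) (hper : IsPeriodic d f) (hnn : ∀ x, 0 ≤ f x)
    {x : Euc d} (hx : x ∈ unitCube d) {t : ℝ} (ht : t ≤ d) :
    ∫ u in Metric.closedBall x t, f u
      ≤ (nearbyShifts d).card * ∫ u in torusBall d x t, f u := by
  have hpre : ∀ m, ∫ u in (fun u => u + intVec d (-m)) ⁻¹' torusBall d x t, f u
      = ∫ u in torusBall d x t, f u := by
    intro m
    have h := (measurePreserving_add_right (volume : Measure (Euc d))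
      (intVec d (-m))).setIntegral_preimage_emb (measurableEmbedding_addRight _) f
      (torusBall d x t)
    simpa only [hper.add_intVec (-m) _] using h
  have hcube : IntegrableOn f (torusBall d x t) :=
    (hf.continuousOn.integrableOn_compact (isCompact_unitCube d)).mono_set Set.inter_subset_left
  have hint : ∀ m, IntegrableOn f ((fun u => u + intVec d (-m)) ⁻¹' torusBall d x t) := by
    intro m
    have h := ((measurePreserving_add_right (volume : Measure (Euc d))
      (intVec d (-m))).integrableOn_comp_preimage (measurableEmbedding_addRight _)
      (f := f) (s := torusBall d x t)).2 hcube
    refine h.congr_fun (fun u _ => hper.add_intVec (-m) u) ?_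
    exact (measurableSet_torusBall x t).preimage (measurable_add_const _)
  refine (setIntegral_mono_set (integrableOn_finset_iUnion.2 fun m _ => hint m)
    (Filter.Eventually.of_forall hnn)
    (closedBall_subset_iUnion_torusBall hx ht).eventuallyLE).trans ?_
  refine (setIntegral_biUnion_finset_le hnn _ fun m _ => hint m).trans ?_
  rw [Finset.sum_congr rfl fun m _ => hpre m, Finset.sum_const, nsmul_eq_mul]

end Torus

section BinomialTail

/-- An exponential bound for the probability that fewer than `k` of `n` samples hit `A`. -/
lemma integral_prod_half_le {α : Type*} [MeasurableSpace α] (μ : Measure α)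
    [IsProbabilityMeasure μ] {A : Set α} (hA : MeasurableSet A) (n : ℕ) :
    ∫ X, ∏ i, (1 - A.indicator (fun _ => (1 / 2 : ℝ)) (X i)) ∂Measure.pi (fun _ : Fin n => μ)
      ≤ Real.exp (-(n * μ.real A / 2)) := by
  have hint : Integrable (A.indicator fun _ => (1 / 2 : ℝ)) μ :=
    (integrable_const _).indicator hA
  rw [integral_fintype_prod_eq_pow (fun y => 1 - A.indicator (fun _ => (1 / 2 : ℝ)) y),
    Fintype.card_fin, integral_sub (integrable_const _) hint, integral_indicator_const _ hA,
    integral_const, probReal_univ, one_smul, smul_eq_mul]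
  have hle : μ.real A ≤ 1 := measureReal_le_one
  calc (1 - μ.real A * (1 / 2)) ^ n ≤ Real.exp (-(μ.real A * (1 / 2))) ^ n := by
        gcongr
        · linarith
        · exact Real.one_sub_le_exp_neg _
    _ = Real.exp (-(n * μ.real A / 2)) := by
        rw [← Real.exp_nat_mul]
        congr 1
        ring

lemma one_le_two_pow_mul_prod_half {α : Type*} {A : Set α} {n k : ℕ} {X : Fin n → α}
    {S : Finset (Fin n)} (hS : ∀ i, X i ∈ A → i ∈ S) (hSk : S.card < k) :
    1 ≤ (2 : ℝ) ^ k * ∏ i, (1 - A.indicator (fun _ => (1 / 2 : ℝ)) (X i)) := by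
  have hprod : (1 / 2 : ℝ) ^ S.card ≤ ∏ i, (1 - A.indicator (fun _ => (1 / 2 : ℝ)) (X i)) := by
    rw [← Finset.prod_const, ← Finset.prod_ite_mem_eq]
    refine Finset.prod_le_prod (fun i _ => by positivity) fun i _ => ?_
    by_cases hi : X i ∈ A
    · simp [hi, hS i hi]
      norm_num
    · simp only [hi, Set.indicator_of_notMem, not_false_eq_true]
      split_ifs <;> norm_num
  calc (1 : ℝ) = 2 ^ S.card * (1 / 2) ^ S.card := by rw [← mul_pow]; norm_num
    _ ≤ _ := by gcongr; norm_num

lemma sq_le_sum_odd {y : ℝ} (hy : 0 ≤ y) {J : ℕ} (hyJ : y ≤ J) :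
    y ^ 2 ≤ ∑ j ∈ Finset.range J, if (j : ℝ) < y then (2 * j + 1 : ℝ) else 0 := by
  have hsum : ∀ m : ℕ, ∑ j ∈ Finset.range m, (2 * j + 1 : ℝ) = (m : ℝ) ^ 2 := by
    intro m
    induction m with
    | zero => simp
    | succ m ih => rw [Finset.sum_range_succ, ih]; push_cast; ring
  calc y ^ 2 ≤ (⌈y⌉₊ : ℝ) ^ 2 := by gcongr; exact Nat.le_ceil y
    _ = ∑ j ∈ Finset.range ⌈y⌉₊, if (j : ℝ) < y then (2 * j + 1 : ℝ) else 0 := by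
        rw [← hsum]
        exact Finset.sum_congr rfl fun j hj =>
          (if_pos (Nat.lt_ceil.1 (Finset.mem_range.1 hj))).symm
    _ ≤ _ := by
        refine Finset.sum_le_sum_of_subset_of_nonneg
          (Finset.range_mono (Nat.ceil_le.2 hyJ)) fun j _ _ => ?_
        split_ifs <;> positivity

lemma summable_odd_mul_geometric {r : ℝ} (hr0 : 0 ≤ r) (hr : r < 1) :
    Summable fun j : ℕ => (2 * j + 1 : ℝ) * r ^ j := by
  have hnorm : ‖r‖ < 1 := by rwa [Real.norm_of_nonneg hr0]
  refine (((summable_pow_mul_geometric_of_norm_lt_one 1 hnorm).mul_left 2).add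
    (summable_geometric_of_norm_lt_one hnorm)).congr fun j => ?_
  ring

end BinomialTail

section Mass

variable {d n k : ℕ} {f : Euc d → ℝ}

lemma densityMeasure_real_apply (hf : Continuous f) (hnn : ∀ x, 0 ≤ f x) {A : Set (Euc d)}
    (hA : MeasurableSet A) (hAd : A ⊆ unitCube d) :
    (densityMeasure d f).real A = ∫ u in A, f u := by
  have hint : IntegrableOn f A :=
    (hf.continuousOn.integrableOn_compact (isCompact_unitCube d)).mono_set hAd
  rw [Measure.real, densityMeasure, withDensity_apply _ hA, Measure.restrict_restrict hA,
    Set.inter_eq_self_of_subset_left hAd,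
    ← ofReal_integral_eq_lintegral_ofReal hint (.of_forall hnn),
    ENNReal.toReal_ofReal (integral_nonneg hnn)]

lemma isProbabilityMeasure_densityMeasure (hf : Continuous f) (hnn : ∀ x, 0 ≤ f x)
    (hone : ∫ u in unitCube d, f u = 1) : IsProbabilityMeasure (densityMeasure d f) := by
  refine ⟨?_⟩
  rw [densityMeasure, withDensity_apply _ MeasurableSet.univ, Measure.restrict_univ,
    ← ofReal_integral_eq_lintegral_ofReal
      (hf.continuousOn.integrableOn_compact (isCompact_unitCube d)) (.of_forall hnn),
    hone, ENNReal.ofReal_one]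

lemma setIntegral_closedBall_mono (hf : Continuous f) (hnn : ∀ x, 0 ≤ f x) (x : Euc d)
    {t t' : ℝ} (h : t ≤ t') :
    ∫ u in Metric.closedBall x t, f u ≤ ∫ u in Metric.closedBall x t', f u :=
  setIntegral_mono_set (hf.continuousOn.integrableOn_compact (isCompact_closedBall x t'))
    (.of_forall hnn) (Metric.closedBall_subset_closedBall h).eventuallyLE

lemma RkOfPoint_nonneg (hk : 1 ≤ k) (hkn : k ≤ n) (x : Euc d) (X : Fin n → Euc d) :
    0 ≤ RkOfPoint d n k x X := by
  obtain ⟨i, hi⟩ := exists_RkOfPoint_eq hk hkn x X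
  exact hi ▸ torusDist_nonneg x (X i)

lemma RkOfPoint_le_dim (hk : 1 ≤ k) (hkn : k ≤ n) (x : Euc d) (X : Fin n → Euc d) :
    RkOfPoint d n k x X ≤ d := by
  obtain ⟨i, hi⟩ := exists_RkOfPoint_eq hk hkn x X
  exact hi ▸ torusDist_le_dim x (X i)

lemma ae_RkOfPoint_pos (hd : 1 ≤ d) (hk : 1 ≤ k) (hkn : k ≤ n)
    [IsProbabilityMeasure (densityMeasure d f)] (x : Euc d) :
    ∀ᵐ X ∂sampleMeasure d n f, 0 < RkOfPoint d n k x X := by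
  have hnull : ∀ᵐ y ∂densityMeasure d f, torusDist d x y ≠ 0 := by
    have hac : densityMeasure d f ≪ volume :=
      (withDensity_absolutelyContinuous _ _).trans Measure.restrict_le_self.absolutelyContinuous
    refine hac.ae_le (mem_ae_iff.2 ?_)
    simpa [Set.compl_ofPred] using volume_torusDist_eq_zero hd x
  have hall : ∀ᵐ X ∂sampleMeasure d n f, ∀ i, torusDist d x (X i) ≠ 0 :=
    ae_all_iff.2 fun i => (Measure.tendsto_eval_ae_ae (μ := fun _ : Fin n => densityMeasure d f)
      (i := i)).eventually hnull
  filter_upwards [hall] with X hX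
  obtain ⟨i, hi⟩ := exists_RkOfPoint_eq hk hkn x X
  exact hi ▸ (torusDist_nonneg x (X i)).lt_of_ne (hX i).symm

lemma setIntegral_closedBall_le_card (hf : Continuous f) (hper : IsPeriodic d f)
    (hnn : ∀ x, 0 ≤ f x) (hone : ∫ u in unitCube d, f u = 1) {x : Euc d} (hx : x ∈ unitCube d)
    {t : ℝ} (ht : t ≤ d) :
    ∫ u in Metric.closedBall x t, f u ≤ (nearbyShifts d).card := by
  refine (setIntegral_closedBall_le hf hper hnn hx ht).trans (mul_le_of_le_one_right
    (Nat.cast_nonneg _) ?_)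
  rw [← hone]
  exact setIntegral_mono_set (hf.continuousOn.integrableOn_compact (isCompact_unitCube d))
    (.of_forall hnn) Set.inter_subset_left.eventuallyLE

/-- If the ball of radius `R_k(x)` has mass more than `c`, then fewer than `k` samples lie in some
set of probability comparable with `c`. -/
lemma exists_set_few_samples (hd : 1 ≤ d) (hk : 1 ≤ k) (hkn : k ≤ n) (hf : Continuous f)
    (hper : IsPeriodic d f) (hnn : ∀ x, 0 ≤ f x) (hone : ∫ u in unitCube d, f u = 1)
    {x : Euc d} (hx : x ∈ unitCube d) {c : ℝ} (hc : 0 ≤ c) (hcM : c ≤ (nearbyShifts d).card) :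
    ∃ A, MeasurableSet A ∧ c / (nearbyShifts d).card ≤ (densityMeasure d f).real A ∧
      ∀ X : Fin n → Euc d, c < ∫ u in Metric.closedBall x (RkOfPoint d n k x X), f u →
        ∃ S : Finset (Fin n), (∀ i, X i ∈ A → i ∈ S) ∧ S.card < k := by
  have hM : (0 : ℝ) < (nearbyShifts d).card := Nat.cast_pos.2 (nearbyShifts_card_pos d)
  rcases hc.eq_or_lt with rfl | hcpos
  · exact ⟨∅, MeasurableSet.empty, by simp, fun X _ => ⟨∅, fun i hi => hi.elim, hk⟩⟩
  by_cases hcd : c ≤ ∫ u in Metric.closedBall x d, f u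
  · obtain ⟨t, -, htd, htc⟩ := exists_setIntegral_closedBall_eq hd hf x (Nat.cast_nonneg d) hcpos hcd
    refine ⟨torusBall d x t, measurableSet_torusBall x t, ?_, fun X hX =>
      ⟨Finset.univ.filter fun i => torusDist d x (X i) ≤ t, fun i hi => ?_, ?_⟩⟩
    · rw [densityMeasure_real_apply hf hnn (measurableSet_torusBall x t) Set.inter_subset_left,
        div_le_iff₀' hM, ← htc]
      exact setIntegral_closedBall_le hf hper hnn hx htd
    · exact Finset.mem_filter.2 ⟨Finset.mem_univ i, torusDist_le_of_mem_torusBall hi⟩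
    · refine card_torusDist_le_lt hk hkn (lt_of_not_ge fun hle => hX.not_ge ?_)
      exact (setIntegral_closedBall_mono hf hnn x hle).trans_eq htc
  · have := isProbabilityMeasure_densityMeasure hf hnn hone
    refine ⟨Set.univ, MeasurableSet.univ, ?_, fun X hX => (hcd ?_).elim⟩
    · rw [probReal_univ]
      exact (div_le_one hM).2 hcM
    · exact hX.le.trans (setIntegral_closedBall_mono hf hnn x (RkOfPoint_le_dim hk hkn x X))

/-- Bound for the second moment of `n` times the mass of the ball of radius `R_k(x)`. -/
noncomputable def massMomentBound (d k : ℕ) : ℝ :=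
  2 ^ k * ∑' j : ℕ, (2 * j + 1 : ℝ) * Real.exp (-(1 / (2 * (nearbyShifts d).card))) ^ j

lemma massMomentBound_nonneg (d k : ℕ) : 0 ≤ massMomentBound d k :=
  mul_nonneg (by positivity) (tsum_nonneg fun _ => by positivity)

lemma exists_integrable_ge_mass_sq (hd : 1 ≤ d) (hk : 1 ≤ k) (hkn : k ≤ n) (hf : Continuous f)
    (hper : IsPeriodic d f) (hnn : ∀ x, 0 ≤ f x) (hone : ∫ u in unitCube d, f u = 1)
    {x : Euc d} (hx : x ∈ unitCube d) :
    ∃ h : (Fin n → Euc d) → ℝ, Integrable h (sampleMeasure d n f) ∧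
      (∀ X, (n * ∫ u in Metric.closedBall x (RkOfPoint d n k x X), f u) ^ 2 ≤ h X) ∧
      ∫ X, h X ∂sampleMeasure d n f ≤ massMomentBound d k := by
  have := isProbabilityMeasure_densityMeasure hf hnn hone
  set M := (nearbyShifts d).card
  have hM : (0 : ℝ) < M := Nat.cast_pos.2 (nearbyShifts_card_pos d)
  have hn : (0 : ℝ) < n := Nat.cast_pos.2 (by omega)
  have hset : ∀ j : ℕ, ∃ A, MeasurableSet A ∧ (j < n * M →
      ((j : ℝ) / n) / M ≤ (densityMeasure d f).real A ∧
      ∀ X : Fin n → Euc d, (j : ℝ) / n < ∫ u in Metric.closedBall x (RkOfPoint d n k x X), f u →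
        ∃ S : Finset (Fin n), (∀ i, X i ∈ A → i ∈ S) ∧ S.card < k) := by
    intro j
    by_cases hj : j < n * M
    · have hjM : (j : ℝ) / n ≤ M := by
        rw [div_le_iff₀' hn]
        exact_mod_cast hj.le
      obtain ⟨A, hA, hAc⟩ := exists_set_few_samples hd hk hkn hf hper hnn hone hx
        (div_nonneg (Nat.cast_nonneg j) hn.le) hjM
      exact ⟨A, hA, fun _ => hAc⟩
    · exact ⟨∅, MeasurableSet.empty, fun h => (hj h).elim⟩
  choose A hA hAc using hset
  set g : ℕ → (Fin n → Euc d) → ℝ := fun j X =>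
    ∏ i, (1 - (A j).indicator (fun _ => (1 / 2 : ℝ)) (X i))
  have hg0 : ∀ j X, 0 ≤ g j X := fun j X => Finset.prod_nonneg fun i _ => by
    by_cases hi : X i ∈ A j <;> simp [hi]
    norm_num
  have hgint : ∀ j, Integrable (g j) (sampleMeasure d n f) := fun j =>
    Integrable.fintype_prod (f := fun _ y => 1 - (A j).indicator (fun _ => (1 / 2 : ℝ)) y)
      fun _ => (integrable_const _).sub ((integrable_const _).indicator (hA j))
  set r : ℝ := Real.exp (-(1 / (2 * M)))
  have hr : r < 1 := by
    refine Real.exp_zero ▸ Real.exp_lt_exp.2 ?_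
    simpa using hM
  refine ⟨fun X => ∑ j ∈ Finset.range (n * M), (2 * j + 1) * (2 ^ k * g j X),
    integrable_finsetSum _ fun j _ => ((hgint j).const_mul _).const_mul _, fun X => ?_, ?_⟩
  · refine (sq_le_sum_odd (J := n * M) (mul_nonneg hn.le (integral_nonneg hnn)) ?_).trans ?_
    · push_cast
      gcongr
      exact setIntegral_closedBall_le_card hf hper hnn hone hx (RkOfPoint_le_dim hk hkn x X)
    · refine Finset.sum_le_sum fun j hj => ?_
      split_ifs with hlt
      · obtain ⟨S, hS, hSk⟩ := (hAc j (Finset.mem_range.1 hj)).2 X ((div_lt_iff₀' hn).2 hlt)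
        exact le_mul_of_one_le_right (by positivity) (one_le_two_pow_mul_prod_half hS hSk)
      · have := hg0 j X
        positivity
  · rw [integral_finsetSum _ fun j _ => ((hgint j).const_mul _).const_mul _]
    calc ∑ j ∈ Finset.range (n * M), ∫ X, (2 * j + 1) * (2 ^ k * g j X) ∂sampleMeasure d n f
        ≤ ∑ j ∈ Finset.range (n * M), 2 ^ k * ((2 * j + 1) * r ^ j) := by
          refine Finset.sum_le_sum fun j hj => ?_
          rw [integral_const_mul, integral_const_mul, mul_left_comm]
          gcongr
          refine (integral_prod_half_le (densityMeasure d f) (hA j) n).trans ?_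
          rw [← Real.exp_nat_mul]
          gcongr
          have hp := (hAc j (Finset.mem_range.1 hj)).1
          calc (j : ℝ) * -(1 / (2 * M)) = -(n * ((j : ℝ) / n / M) / 2) := by field_simp
            _ ≥ _ := by gcongr
      _ ≤ massMomentBound d k := by
          rw [← Finset.mul_sum, massMomentBound]
          gcongr
          exact (summable_odd_mul_geometric (Real.exp_nonneg _) hr).sum_le_tsum _
            fun j _ => by positivity

end Mass

section PointwiseError

variable {d n : ℕ} {s L : ℝ} {f : Euc d → ℝ}

/-- The error of the ball average of radius `R`, compared with the radius `n ^ (-1 / (s + d))`. -/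
lemma abs_ballAvg_sub_le_of_mass (hd : 1 ≤ d) (hs : 0 < s) (hL : 0 ≤ L) (hn : 1 ≤ n)
    (hf : IsHolderOrder d s L f) (hnn : ∀ x, 0 ≤ f x) (x : Euc d) {R : ℝ} (hR : 0 < R) :
    |ballAvg d f R x - f x| ≤ (n : ℝ) ^ (-(s / (s + d))) *
      (L + (n * ∫ u in Metric.closedBall x R, f u) / unitBallVol d) := by
  have hV := unitBallVol_pos d
  have hn0 : (0 : ℝ) < n := by exact_mod_cast hn
  have hsd : 0 < s + d := by positivity
  set δ := (n : ℝ) ^ (-(s / (s + d)))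
  have hδ : 0 < δ := Real.rpow_pos_of_pos hn0 _
  set t := (n : ℝ) ^ (-(1 / (s + d))) with ht_def
  have ht : 0 < t := Real.rpow_pos_of_pos hn0 _
  have hts : t ^ s = δ := by
    rw [ht_def, ← Real.rpow_mul hn0.le]
    congr 1
    field_simp
  have htd : t ^ d = (δ * n)⁻¹ := by
    rw [ht_def, ← Real.rpow_natCast, ← Real.rpow_mul hn0.le, ← Real.rpow_add_one hn0.ne',
      ← Real.rpow_neg hn0.le]
    congr 1
    field_simp
    ring
  set F : ℝ → ℝ := fun t => ∫ u in Metric.closedBall x t, f u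
  have hF : ∀ t, 0 ≤ F t := fun t => integral_nonneg hnn
  rcases le_or_gt R t with hRt | htR
  · calc |ballAvg d f R x - f x| ≤ L * R ^ s := abs_ballAvg_sub_le hd hs hL hf x hR
      _ ≤ L * t ^ s := by gcongr
      _ = δ * L := by rw [hts, mul_comm]
      _ ≤ δ * (L + n * F R / unitBallVol d) := by
        have := hF R
        gcongr
        exact le_add_of_nonneg_right (by positivity)
  · have havg : ∀ r, 0 < r → t ≤ r → r ≤ R →
        ballAvg d f r x ≤ δ * (n * F R / unitBallVol d) := by
      intro r hr htr hrR
      have hFr : F r ≤ F R := setIntegral_closedBall_mono (hf.continuous hs) hnn x hrR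
      have h0 := hF r
      calc ballAvg d f r x = F r / (unitBallVol d * r ^ d) := by rw [ballAvg]; ring
        _ ≤ F R / (unitBallVol d * t ^ d) := by gcongr; exact hF R
        _ = δ * (n * F R / unitBallVol d) := by rw [htd]; field_simp
    have h1 := havg R hR htR.le le_rfl
    have h2 := havg t ht le_rfl htR.le
    have h3 := (abs_le.1 (abs_ballAvg_sub_le hd hs hL hf x ht)).1
    rw [hts] at h3
    have h4 : 0 ≤ ballAvg d f R x := mul_nonneg (by positivity) (hF R)
    have h5 := hnn x
    have h6 : 0 ≤ δ * L := by positivity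
    change _ ≤ δ * (L + n * F R / unitBallVol d)
    rw [abs_le, mul_add]
    constructor <;> linarith

end PointwiseError

noncomputable section

/-- Pointwise mean-squared-error bound for the `k`-NN density
estimate: `E[(f_{R_k(x)}(x) - f(x))²] ≤ C n^{-2s/(s+d)}`. -/
theorem knn_density_mse_upper_bound (d k : ℕ) (hd : 1 ≤ d) (hk : 1 ≤ k)
    (s L : ℝ) (hs : 0 < s) (hs2 : s ≤ 2) (hL : 0 < L) :
    ∃ C : ℝ, 0 < C ∧ ∀ n : ℕ, k ≤ n → ∀ f : Euc d → ℝ, HolderDensity d s L f →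
      ∀ x ∈ unitCube d,
        (∫ X, (ballAvg d f (RkOfPoint d n k x X) x - f x) ^ 2 ∂ sampleMeasure d n f)
          ≤ C * (n : ℝ) ^ (-(2 * s / (s + d))) := by
  have hV := unitBallVol_pos d
  set B := massMomentBound d k
  have hB : 0 ≤ B := massMomentBound_nonneg d k
  refine ⟨2 * L ^ 2 + 2 / unitBallVol d ^ 2 * B, by positivity, fun n hkn f hf x hx => ?_⟩
  obtain ⟨hhol, hper, hnn, hone⟩ := hf
  have hcont := hhol.continuous hs
  have := isProbabilityMeasure_densityMeasure hcont hnn hone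
  have : IsProbabilityMeasure (sampleMeasure d n f) := by
    unfold sampleMeasure
    infer_instance
  have hn0 : (0 : ℝ) ≤ n := Nat.cast_nonneg n
  obtain ⟨h, hint, hle, hbound⟩ := exists_integrable_ge_mass_sq hd hk hkn hcont hper hnn hone hx
  set δ := (n : ℝ) ^ (-(s / (s + d)))
  have hδ2 : (n : ℝ) ^ (-(2 * s / (s + d))) = δ ^ 2 := by
    rw [← Real.rpow_mul_natCast hn0]
    congr 1
    push_cast
    ring
  have hdom : Integrable (fun X => δ ^ 2 * (2 * L ^ 2 + 2 / unitBallVol d ^ 2 * h X))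
      (sampleMeasure d n f) := ((integrable_const _).add (hint.const_mul _)).const_mul _
  refine (integral_mono_of_nonneg (.of_forall fun X => sq_nonneg _) hdom ?_).trans ?_
  · filter_upwards [ae_RkOfPoint_pos hd hk hkn x] with X hX
    have herr := abs_ballAvg_sub_le_of_mass hd hs hL.le (hk.trans hkn) hhol hnn x hX
    set y := n * ∫ u in Metric.closedBall x (RkOfPoint d n k x X), f u
    calc (ballAvg d f (RkOfPoint d n k x X) x - f x) ^ 2
        ≤ (δ * (L + y / unitBallVol d)) ^ 2 := sq_le_sq.2 (herr.trans (le_abs_self _))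
      _ = δ ^ 2 * (L + y / unitBallVol d) ^ 2 := mul_pow _ _ _
      _ ≤ δ ^ 2 * (2 * (L ^ 2 + (y / unitBallVol d) ^ 2)) := by gcongr; exact add_sq_le
      _ = δ ^ 2 * (2 * L ^ 2 + 2 / unitBallVol d ^ 2 * y ^ 2) := by ring
      _ ≤ δ ^ 2 * (2 * L ^ 2 + 2 / unitBallVol d ^ 2 * h X) := by gcongr; exact hle X
  · rw [integral_const_mul, integral_add (integrable_const _) (hint.const_mul _),
      integral_const, integral_const_mul, probReal_univ, one_smul, hδ2, mul_comm]
    gcongr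

end
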